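/- arXiv:1808.10209 — 7 statements merged into one kernel-verified Lean document; each statement's English description precedes it below -/
import Mathlib

section
/- Consider the SSSCG with one follower (|F| = 1), two resources R = {r1, r2}, and costs c_{r1,ℓ}(1) = 2, c_{r1,ℓ}(2) = 0; c_{r2,ℓ}(1) = 2, c_{r2,ℓ}(2) = 2; c_{r1,f}(1) = c_{r2,f}(1) = 1, c_{r1,f}(2) = c_{r2,f}(2) = 2. Then: (a) for every leader strategy σ_ℓ, max_{ν ∈ E^{σ_ℓ}} c_ℓ^{(σ_ℓ,ν)} > 1; (b) for every rational δ > 0 there exists a leader strategy σ_ℓ with max_{ν ∈ E^{σ_ℓ}} c_ℓ^{(σ_ℓ,ν)} < 1 + δ. Consequently, this game admits no pessimistic Stackelberg equilibrium (PSE). -/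
open Finset

/-- A leader strategy: a probability distribution over the resources. -/
def IsStrategy {R : Type} [Fintype R] (σ : R → ℚ) : Prop :=
  (∀ i, 0 ≤ σ i) ∧ ∑ i, σ i = 1

/-- A followers' configuration: `nF` followers distributed over the resources. -/
def IsConfig {R : Type} [Fintype R] (nF : ℕ) (ν : R → ℕ) : Prop :=
  ∑ i, ν i = nF

/-- Followers' expected cost of a resource with cost function `c`, selected by the leader
with probability `p`, when `x` followers select it:
`c^{σ_ℓ}(x) = σ_ℓ(i)·c(x+1) + (1−σ_ℓ(i))·c(x)`. -/
def expCost (c : ℕ → ℚ) (p : ℚ) (x : ℕ) : ℚ := p * c (x + 1) + (1 - p) * c x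

/-- `ν` is a Nash equilibrium of the followers' game induced by the leader's strategy `σ`:
no follower can strictly decrease her cost by deviating to another resource. -/
def IsNE {R : Type} [Fintype R] (cf : R → ℕ → ℚ) (σ : R → ℚ) (ν : R → ℕ) : Prop :=
  ∀ i j, i ≠ j → 0 < ν i → expCost (cf i) (σ i) (ν i) ≤ expCost (cf j) (σ j) (ν j + 1)

/-- The leader's expected cost: `Σ_i σ_ℓ(i)·c_{i,ℓ}(ν_i + 1)`. -/
def leaderCost {R : Type} [Fintype R] (cl : R → ℕ → ℚ) (σ : R → ℚ) (ν : R → ℕ) : ℚ :=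
  ∑ i, σ i * cl i (ν i + 1)

/-- Leader's costs: `c_{r1,ℓ}(1) = 2, c_{r1,ℓ}(2) = 0`; `c_{r2,ℓ}(1) = 2, c_{r2,ℓ}(2) = 2`. -/
def cl0 : Fin 2 → ℕ → ℚ := fun i x =>
  if x = 0 then 0
  else if i = 0 then (if x = 1 then 2 else 0)
  else 2

/-- Followers' costs: `c_{r,f}(1) = 1, c_{r,f}(2) = 2` on both resources. -/
def cf0 : Fin 2 → ℕ → ℚ := fun _ x =>
  if x = 0 then 0 else if x = 1 then 1 else 2

theorem isStrategy_fin_two_iff (σ : Fin 2 → ℚ) :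
    IsStrategy σ ↔ 0 ≤ σ 0 ∧ σ 0 ≤ 1 ∧ σ 1 = 1 - σ 0 := by
  simp only [IsStrategy, Fin.forall_fin_two, Fin.sum_univ_two]
  constructor
  · rintro ⟨⟨h0, h1⟩, h⟩
    exact ⟨h0, by linarith, by linarith⟩
  · rintro ⟨h0, h1, h⟩
    exact ⟨⟨h0, by linarith⟩, by linarith⟩

theorem isConfig_one_iff (ν : Fin 2 → ℕ) : IsConfig 1 ν ↔ ν = ![1, 0] ∨ ν = ![0, 1] := by
  simp only [IsConfig, Fin.sum_univ_two, funext_iff, Fin.forall_fin_two, Matrix.cons_val_zero,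
    Matrix.cons_val_one]
  omega

theorem isNE_first_iff {σ : Fin 2 → ℚ} (hσ : IsStrategy σ) :
    IsNE cf0 σ ![1, 0] ↔ σ 0 ≤ 1 / 2 := by
  obtain ⟨-, -, h⟩ := (isStrategy_fin_two_iff σ).1 hσ
  simp only [IsNE, Fin.forall_fin_two, expCost, cf0, h]
  norm_num
  constructor <;> intro <;> linarith

theorem isNE_second_iff {σ : Fin 2 → ℚ} (hσ : IsStrategy σ) :
    IsNE cf0 σ ![0, 1] ↔ 1 / 2 ≤ σ 0 := by
  obtain ⟨-, -, h⟩ := (isStrategy_fin_two_iff σ).1 hσ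
  simp only [IsNE, Fin.forall_fin_two, expCost, cf0, h]
  norm_num
  constructor <;> intro <;> linarith

theorem leaderCost_first {σ : Fin 2 → ℚ} (hσ : IsStrategy σ) :
    leaderCost cl0 σ ![1, 0] = 2 - 2 * σ 0 := by
  obtain ⟨-, -, h⟩ := (isStrategy_fin_two_iff σ).1 hσ
  simp [leaderCost, Fin.sum_univ_two, cl0, h]
  ring

theorem leaderCost_second {σ : Fin 2 → ℚ} (hσ : IsStrategy σ) :
    leaderCost cl0 σ ![0, 1] = 2 := by
  obtain ⟨-, -, h⟩ := (isStrategy_fin_two_iff σ).1 hσ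
  simp [leaderCost, Fin.sum_univ_two, cl0, h]
  ring

theorem exists_isNE_one_lt_leaderCost (σ : Fin 2 → ℚ) (hσ : IsStrategy σ) :
    ∃ ν : Fin 2 → ℕ, IsConfig 1 ν ∧ IsNE cf0 σ ν ∧ 1 < leaderCost cl0 σ ν := by
  rcases lt_or_ge (σ 0) (1 / 2) with h | h
  · refine ⟨![1, 0], (isConfig_one_iff _).2 (Or.inl rfl), (isNE_first_iff hσ).2 h.le, ?_⟩
    rw [leaderCost_first hσ]
    linarith
  · refine ⟨![0, 1], (isConfig_one_iff _).2 (Or.inr rfl), (isNE_second_iff hσ).2 h, ?_⟩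
    rw [leaderCost_second hσ]
    norm_num

theorem exists_isStrategy_leaderCost_lt (δ : ℚ) (hδ : 0 < δ) :
    ∃ σ : Fin 2 → ℚ, IsStrategy σ ∧
      ∀ ν : Fin 2 → ℕ, IsConfig 1 ν → IsNE cf0 σ ν → leaderCost cl0 σ ν < 1 + δ := by
  obtain ⟨ε, hε, hεδ⟩ := exists_between (show (0 : ℚ) < min (δ / 2) (1 / 2) by positivity)
  obtain ⟨hεδ, hε'⟩ := lt_min_iff.1 hεδ
  have hσ : IsStrategy ![1 / 2 - ε, 1 / 2 + ε] := by
    simp only [isStrategy_fin_two_iff, Matrix.cons_val_zero, Matrix.cons_val_one]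
    exact ⟨by linarith, by linarith, by ring⟩
  refine ⟨_, hσ, fun ν hν hNE => ?_⟩
  rcases (isConfig_one_iff ν).1 hν with rfl | rfl
  · rw [leaderCost_first hσ, Matrix.cons_val_zero]
    linarith
  · rw [isNE_second_iff hσ, Matrix.cons_val_zero] at hNE
    linarith

theorem stmt0 :
    -- (a) for every leader strategy, some NE gives the leader cost > 1
    (∀ σ : Fin 2 → ℚ, IsStrategy σ →
      ∃ ν : Fin 2 → ℕ, IsConfig 1 ν ∧ IsNE cf0 σ ν ∧ 1 < leaderCost cl0 σ ν) ∧
    -- (b) for every δ > 0 there is a leader strategy whose worst NE cost is < 1 + δ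
    (∀ δ : ℚ, 0 < δ →
      ∃ σ : Fin 2 → ℚ, IsStrategy σ ∧
        ∀ ν : Fin 2 → ℕ, IsConfig 1 ν → IsNE cf0 σ ν →
          leaderCost cl0 σ ν < 1 + δ) ∧
    -- consequently, no pessimistic Stackelberg equilibrium exists
    ¬ ∃ (σ : Fin 2 → ℚ) (ν : Fin 2 → ℕ),
        IsStrategy σ ∧ IsConfig 1 ν ∧ IsNE cf0 σ ν ∧
        (∀ ν'' : Fin 2 → ℕ, IsConfig 1 ν'' → IsNE cf0 σ ν'' →
          leaderCost cl0 σ ν'' ≤ leaderCost cl0 σ ν) ∧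
        (∀ σ' : Fin 2 → ℚ, IsStrategy σ' →
          ∃ ν' : Fin 2 → ℕ, IsConfig 1 ν' ∧ IsNE cf0 σ' ν' ∧
            leaderCost cl0 σ ν ≤ leaderCost cl0 σ' ν') := by
  refine ⟨exists_isNE_one_lt_leaderCost, exists_isStrategy_leaderCost_lt, ?_⟩
  rintro ⟨σ, ν, hσ, -, -, hmax, hmin⟩
  obtain ⟨ν₁, hν₁, hNE₁, hlt⟩ := exists_isNE_one_lt_leaderCost σ hσ
  have hν : 1 < leaderCost cl0 σ ν := hlt.trans_le (hmax ν₁ hν₁ hNE₁)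
  obtain ⟨σ', hσ', hbound⟩ :=
    exists_isStrategy_leaderCost_lt (leaderCost cl0 σ ν - 1) (sub_pos.2 hν)
  obtain ⟨ν', hν', hNE', hle⟩ := hmin σ' hσ'
  linarith [hbound ν' hν' hNE']
end

section
/- Every SSSCG in which all leader's and followers' cost functions are weakly monotonic admits an optimistic Stackelberg equilibrium (σ_ℓ, ν) in which the leader's strategy σ_ℓ is pure; that is, there exist a resource i* and a configuration ν ∈ E^{σ_ℓ}, where σ_ℓ is the pure strategy on i*, such that c_ℓ^{(σ_ℓ,ν)} ≤ c_ℓ^{(σ'_ℓ,ν')} for every leader strategy σ'_ℓ and every ν' ∈ E^{σ'_ℓ}. -/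
open Finset

/-- The pure leader strategy on resource `i`. -/
def pureStrat {R : Type} [DecidableEq R] (i : R) : R → ℚ := fun j => if j = i then 1 else 0

/-- The configuration obtained from `ν` when one follower moves from resource `i` to `j`. -/
def moveFollower {R : Type} [DecidableEq R] (ν : R → ℕ) (i j : R) : R → ℕ :=
  Function.update (Function.update ν i (ν i - 1)) j (ν j + 1)

/-- Rosenthal's potential of the singleton congestion game with cost functions `a`. -/
def rosenthalPotential {R : Type} [Fintype R] (a : R → ℕ → ℚ) (ν : R → ℕ) : ℚ :=
  ∑ k, ∑ x ∈ range (ν k), a k (x + 1)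

section

variable {R : Type} [DecidableEq R]

theorem moveFollower_source (ν : R → ℕ) {i j : R} (hij : i ≠ j) :
    moveFollower ν i j i = ν i - 1 := by
  simp [moveFollower, hij]

theorem moveFollower_target (ν : R → ℕ) (i j : R) : moveFollower ν i j j = ν j + 1 := by
  simp [moveFollower]

theorem moveFollower_of_ne (ν : R → ℕ) {i j k : R} (hi : k ≠ i) (hj : k ≠ j) :
    moveFollower ν i j k = ν k := by
  simp [moveFollower, hi, hj]

variable [Fintype R]

theorem sum_moveFollower (f : R → ℕ → ℚ) (ν : R → ℕ) {i j : R} (hij : i ≠ j) :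
    ∑ k, f k (moveFollower ν i j k) =
      ∑ k, f k (ν k) + (f i (ν i - 1) - f i (ν i)) + (f j (ν j + 1) - f j (ν j)) := by
  have h : ∑ k, (f k (moveFollower ν i j k) - f k (ν k)) =
      (f i (moveFollower ν i j i) - f i (ν i)) + (f j (moveFollower ν i j j) - f j (ν j)) :=
    Fintype.sum_eq_add i j hij fun k hk => by rw [moveFollower_of_ne ν hk.1 hk.2, sub_self]
  rw [moveFollower_source ν hij, moveFollower_target, sum_sub_distrib] at h
  linarith

theorem IsConfig.moveFollower {nF : ℕ} {ν : R → ℕ} (hν : IsConfig nF ν) {i j : R}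
    (hij : i ≠ j) (hi : 0 < ν i) : IsConfig nF (moveFollower ν i j) := by
  have h := sum_moveFollower (fun _ x => (x : ℚ)) ν hij
  rw [Nat.cast_pred hi] at h
  have h' : ((∑ k, _root_.moveFollower ν i j k : ℕ) : ℚ) = ((∑ k, ν k : ℕ) : ℚ) := by
    push_cast at h ⊢
    linarith
  exact (Nat.cast_injective h').trans hν

theorem rosenthalPotential_moveFollower (a : R → ℕ → ℚ) (ν : R → ℕ) {i j : R}
    (hij : i ≠ j) (hi : 0 < ν i) :
    rosenthalPotential a (moveFollower ν i j) =
      rosenthalPotential a ν - a i (ν i) + a j (ν j + 1) := by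
  have h := sum_moveFollower (fun k n => ∑ x ∈ range n, a k (x + 1)) ν hij
  obtain ⟨n, hn⟩ := Nat.exists_eq_succ_of_ne_zero hi.ne'
  simp only [hn, Nat.succ_eq_add_one, Nat.add_sub_cancel, sum_range_succ] at h
  simp only [rosenthalPotential, h, hn]
  ring

end

theorem exists_isConfig {R : Type} [Fintype R] [DecidableEq R] [Nonempty R] (nF : ℕ) :
    ∃ ν : R → ℕ, IsConfig nF ν :=
  ⟨Pi.single (Classical.arbitrary R) nF, by simp [IsConfig]⟩

/-- Among the minimizers of Rosenthal's potential there is one with the least congestion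
on a given resource `i`. -/
theorem exists_potential_minimizer {R : Type} [Fintype R] [DecidableEq R] [Nonempty R]
    (nF : ℕ) (a : R → ℕ → ℚ) (i : R) :
    ∃ ν : R → ℕ, IsConfig nF ν ∧ ∀ μ, IsConfig nF μ →
      rosenthalPotential a ν ≤ rosenthalPotential a μ ∧
        (rosenthalPotential a μ ≤ rosenthalPotential a ν → ν i ≤ μ i) := by
  have hmem : ∀ μ : R → ℕ, μ ∈ piAntidiag univ nF ↔ IsConfig nF μ := by
    simp [IsConfig]
  obtain ⟨ν₀, hν₀⟩ := exists_isConfig (R := R) nF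
  obtain ⟨ν, hν, hmin⟩ := exists_min_image (piAntidiag univ nF)
    (fun μ : R → ℕ => toLex (rosenthalPotential a μ, μ i)) ⟨ν₀, (hmem ν₀).2 hν₀⟩
  refine ⟨ν, (hmem ν).1 hν, fun μ hμ => ?_⟩
  rcases Prod.Lex.toLex_le_toLex.1 (hmin μ ((hmem μ).2 hμ)) with h | h
  · exact ⟨h.le, fun h' => absurd h h'.not_gt⟩
  · exact ⟨h.1.le, fun _ => h.2⟩

theorem le_expCost {c : ℕ → ℚ} (hc : ∀ x, c x ≤ c (x + 1)) {p : ℚ} (hp : 0 ≤ p) (x : ℕ) :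
    c x ≤ expCost c p x := by
  have := mul_nonneg hp (sub_nonneg.2 (hc x))
  unfold expCost
  linarith

theorem expCost_le {c : ℕ → ℚ} (hc : ∀ x, c x ≤ c (x + 1)) {p : ℚ} (hp : p ≤ 1) (x : ℕ) :
    expCost c p x ≤ c (x + 1) := by
  have := mul_nonneg (sub_nonneg.2 hp) (sub_nonneg.2 (hc x))
  unfold expCost
  linarith

theorem IsStrategy.le_one {R : Type} [Fintype R] {σ : R → ℚ} (hσ : IsStrategy σ) (i : R) :
    σ i ≤ 1 :=
  hσ.2 ▸ single_le_sum (fun k _ => hσ.1 k) (mem_univ i)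

theorem leaderCost_pureStrat {R : Type} [Fintype R] [DecidableEq R] (cl : R → ℕ → ℚ) (i : R)
    (ν : R → ℕ) : leaderCost cl (pureStrat i) ν = cl i (ν i + 1) := by
  simp [leaderCost, pureStrat]

/-- When the leader commits to resource `i`, some followers' equilibrium puts at most as many
followers on `i` as any equilibrium for any leader strategy does. -/
theorem exists_isNE_pureStrat_le {R : Type} [Fintype R] [DecidableEq R] [Nonempty R] (nF : ℕ)
    (cf : R → ℕ → ℚ) (hf : ∀ i x, cf i x ≤ cf i (x + 1)) (i : R) :
    ∃ ν : R → ℕ, IsConfig nF ν ∧ IsNE cf (pureStrat i) ν ∧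
      ∀ (σ' : R → ℚ) (ν' : R → ℕ), IsStrategy σ' → IsConfig nF ν' → IsNE cf σ' ν' →
        ν i ≤ ν' i := by
  obtain ⟨ν, hν, hmin⟩ :=
    exists_potential_minimizer nF (fun k => expCost (cf k) (pureStrat i k)) i
  refine ⟨ν, hν, fun k j hkj hk => ?_, fun σ' ν' hσ' hν' hne => ?_⟩
  · have h := (hmin _ (hν.moveFollower hkj hk)).1
    rw [rosenthalPotential_moveFollower _ _ hkj hk] at h
    linarith
  · by_contra! hlt
    obtain ⟨j, hj⟩ : ∃ j, ν j < ν' j := by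
      by_contra! hle
      exact (sum_lt_sum (fun k _ => hle k) ⟨i, mem_univ i, hlt⟩).ne (hν'.trans hν.symm)
    have hij : i ≠ j := by rintro rfl; omega
    have hi : 0 < ν i := by omega
    have hcost : expCost (cf j) (pureStrat i j) (ν j + 1) ≤
        expCost (cf i) (pureStrat i i) (ν i) :=
      calc expCost (cf j) (pureStrat i j) (ν j + 1)
          = cf j (ν j + 1) := by simp [expCost, pureStrat, hij.symm]
        _ ≤ cf j (ν' j) := monotone_nat_of_le_succ (hf j) hj
        _ ≤ expCost (cf j) (σ' j) (ν' j) := le_expCost (hf j) (hσ'.1 j) _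
        _ ≤ expCost (cf i) (σ' i) (ν' i + 1) := hne j i hij.symm (by omega)
        _ ≤ cf i (ν' i + 1 + 1) := expCost_le (hf i) (hσ'.le_one i) _
        _ ≤ cf i (ν i + 1) := monotone_nat_of_le_succ (hf i) (by omega)
        _ = expCost (cf i) (pureStrat i i) (ν i) := by simp [expCost, pureStrat]
    have h := (hmin _ (hν.moveFollower hij hi)).2 (by
      rw [rosenthalPotential_moveFollower _ _ hij hi]
      linarith)
    rw [moveFollower_source ν hij] at h
    omega

/-- Every SSSCG with weakly monotonic cost functions admits an optimistic Stackelberg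
equilibrium in which the leader's strategy is pure. -/
theorem stmt2 {R : Type} [Fintype R] [DecidableEq R] [Nonempty R] (nF : ℕ)
    (cl cf : R → ℕ → ℚ)
    (hl0 : ∀ i, cl i 0 = 0) (hf0 : ∀ i, cf i 0 = 0)
    (hlmono : ∀ i x, cl i x ≤ cl i (x + 1)) (hfmono : ∀ i x, cf i x ≤ cf i (x + 1)) :
    ∃ (istar : R) (ν : R → ℕ),
      IsConfig nF ν ∧ IsNE cf (pureStrat istar) ν ∧
      ∀ (σ' : R → ℚ) (ν' : R → ℕ), IsStrategy σ' → IsConfig nF ν' → IsNE cf σ' ν' →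
        leaderCost cl (pureStrat istar) ν ≤ leaderCost cl σ' ν' := by
  choose ν hν hne hle using exists_isNE_pureStrat_le nF cf hfmono
  obtain ⟨i, hi⟩ := Finite.exists_min fun k => cl k (ν k k + 1)
  refine ⟨i, ν i, hν i, hne i, fun σ' ν' hσ' hν' hne' => ?_⟩
  calc leaderCost cl (pureStrat i) (ν i) = ∑ k, σ' k * cl i (ν i i + 1) := by
        rw [leaderCost_pureStrat, ← sum_mul, hσ'.2, one_mul]
    _ ≤ leaderCost cl σ' ν' := sum_le_sum fun k _ =>
        mul_le_mul_of_nonneg_left ((hi k).trans (monotone_nat_of_le_succ (hlmono k)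
          (Nat.succ_le_succ (hle k σ' ν' hσ' hν' hne')))) (hσ'.1 k)
end

section
/- Consider the SSSCG with one follower (|F| = 1), two resources R = {r1, r2}, and weakly monotonic costs c_{r1,ℓ}(1) = c_{r2,ℓ}(1) = 1, c_{r1,ℓ}(2) = c_{r2,ℓ}(2) = 2, and c_{r1,f}(1) = c_{r1,f}(2) = c_{r2,f}(1) = c_{r2,f}(2) = 1. Then: (a) every followers' configuration is a Nash equilibrium for every leader strategy; (b) for every leader strategy σ_ℓ, max_{ν ∈ E^{σ_ℓ}} c_ℓ^{(σ_ℓ,ν)} = 1 + max(σ_ℓ(r1), σ_ℓ(r2)); hence (c) a pessimistic Stackelberg equilibrium exists, every PSE has the mixed leader strategy σ_ℓ(r1) = σ_ℓ(r2) = 1/2 with leader's cost 3/2, and no PSE has a pure leader strategy (each pure commitment yields worst-case cost 2). -/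
open Finset

/-- Leader's costs: `c_{r,ℓ}(1) = 1, c_{r,ℓ}(2) = 2` on both resources (weakly monotonic). -/
def cl6 : Fin 2 → ℕ → ℚ := fun _ x => if x = 0 then 0 else if x = 1 then 1 else 2

/-- Followers' costs: `c_{r,f}(1) = c_{r,f}(2) = 1` on both resources (weakly monotonic). -/
def cf6 : Fin 2 → ℕ → ℚ := fun _ x => if x = 0 then 0 else 1

/-- `(σ, ν)` is a pessimistic Stackelberg equilibrium of the game. -/
def IsPSE6 (σ : Fin 2 → ℚ) (ν : Fin 2 → ℕ) : Prop :=
  IsStrategy σ ∧ IsConfig 1 ν ∧ IsNE cf6 σ ν ∧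
  (∀ ν'' : Fin 2 → ℕ, IsConfig 1 ν'' → IsNE cf6 σ ν'' →
    leaderCost cl6 σ ν'' ≤ leaderCost cl6 σ ν) ∧
  (∀ σ' : Fin 2 → ℚ, IsStrategy σ' →
    ∃ ν' : Fin 2 → ℕ, IsConfig 1 ν' ∧ IsNE cf6 σ' ν' ∧
      leaderCost cl6 σ ν ≤ leaderCost cl6 σ' ν')

theorem isNE_cf6 (σ : Fin 2 → ℚ) (ν : Fin 2 → ℕ) : IsNE cf6 σ ν := by
  intro i j _ hi
  simp [expCost, cf6, hi.ne']

theorem IsStrategy.add_eq_one {σ : Fin 2 → ℚ} (hσ : IsStrategy σ) : σ 0 + σ 1 = 1 := by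
  simpa [Fin.sum_univ_two] using hσ.2

theorem leaderCost_cl6_left {σ : Fin 2 → ℚ} (hσ : IsStrategy σ) :
    leaderCost cl6 σ ![1, 0] = 1 + σ 0 := by
  have := hσ.add_eq_one
  simp [leaderCost, cl6, Fin.sum_univ_two]
  linarith

theorem leaderCost_cl6_right {σ : Fin 2 → ℚ} (hσ : IsStrategy σ) :
    leaderCost cl6 σ ![0, 1] = 1 + σ 1 := by
  have := hσ.add_eq_one
  simp [leaderCost, cl6, Fin.sum_univ_two]
  linarith

theorem exists_leaderCost_cl6_eq {σ : Fin 2 → ℚ} (hσ : IsStrategy σ) :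
    ∃ ν : Fin 2 → ℕ, IsConfig 1 ν ∧ IsNE cf6 σ ν ∧
      leaderCost cl6 σ ν = 1 + max (σ 0) (σ 1) := by
  rcases le_total (σ 0) (σ 1) with h | h
  · exact ⟨![0, 1], (isConfig_one_iff _).2 (Or.inr rfl), isNE_cf6 _ _, by
      rw [leaderCost_cl6_right hσ, max_eq_right h]⟩
  · exact ⟨![1, 0], (isConfig_one_iff _).2 (Or.inl rfl), isNE_cf6 _ _, by
      rw [leaderCost_cl6_left hσ, max_eq_left h]⟩

theorem leaderCost_cl6_le {σ : Fin 2 → ℚ} (hσ : IsStrategy σ) {ν : Fin 2 → ℕ}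
    (hν : IsConfig 1 ν) : leaderCost cl6 σ ν ≤ 1 + max (σ 0) (σ 1) := by
  rcases (isConfig_one_iff ν).1 hν with rfl | rfl
  · rw [leaderCost_cl6_left hσ]
    gcongr
    exact le_max_left _ _
  · rw [leaderCost_cl6_right hσ]
    gcongr
    exact le_max_right _ _

theorem isStrategy_half : IsStrategy (fun _ : Fin 2 => (1 / 2 : ℚ)) :=
  ⟨fun _ => by norm_num, by norm_num [Fin.sum_univ_two]⟩

theorem IsStrategy.half_le_max {σ : Fin 2 → ℚ} (hσ : IsStrategy σ) :
    1 / 2 ≤ max (σ 0) (σ 1) := by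
  have := hσ.add_eq_one
  have := le_max_left (σ 0) (σ 1)
  have := le_max_right (σ 0) (σ 1)
  linarith

theorem exists_isPSE6 : ∃ (σ : Fin 2 → ℚ) (ν : Fin 2 → ℕ), IsPSE6 σ ν := by
  obtain ⟨ν, hν, hNE, hcost⟩ := exists_leaderCost_cl6_eq isStrategy_half
  refine ⟨_, ν, isStrategy_half, hν, hNE, fun ν' hν' _ => ?_, fun σ' hσ' => ?_⟩
  · rw [hcost]
    exact leaderCost_cl6_le isStrategy_half hν'
  · obtain ⟨ν', hν', hNE', hcost'⟩ := exists_leaderCost_cl6_eq hσ'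
    refine ⟨ν', hν', hNE', ?_⟩
    rw [hcost, hcost', max_self]
    gcongr
    exact hσ'.half_le_max

theorem IsPSE6.eq_half {σ : Fin 2 → ℚ} {ν : Fin 2 → ℕ} (h : IsPSE6 σ ν) :
    σ 0 = 1 / 2 ∧ σ 1 = 1 / 2 ∧ leaderCost cl6 σ ν = 3 / 2 := by
  obtain ⟨hσ, -, -, hworst, hopt⟩ := h
  obtain ⟨ν₁, hν₁, hNE₁, hcost₁⟩ := exists_leaderCost_cl6_eq hσ
  obtain ⟨ν₂, hν₂, -, hle⟩ := hopt _ isStrategy_half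
  have h₁ := hworst ν₁ hν₁ hNE₁
  have h₂ := leaderCost_cl6_le isStrategy_half hν₂
  rw [max_self] at h₂
  have := hσ.add_eq_one
  have := le_max_left (σ 0) (σ 1)
  have := le_max_right (σ 0) (σ 1)
  refine ⟨?_, ?_, ?_⟩ <;> linarith

theorem IsStrategy.max_eq_one {σ : Fin 2 → ℚ} (hσ : IsStrategy σ) (h : ∃ i, σ i = 1) :
    max (σ 0) (σ 1) = 1 := by
  have h0 := hσ.1 0
  have h1 := hσ.1 1
  have := hσ.add_eq_one
  rcases Fin.exists_fin_two.1 h with h | h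
  · rw [h, max_eq_left]
    linarith
  · rw [h, max_eq_right]
    linarith

theorem stmt6 :
    -- (a) every configuration is an NE for every leader strategy
    (∀ σ : Fin 2 → ℚ, IsStrategy σ → ∀ ν : Fin 2 → ℕ, IsConfig 1 ν → IsNE cf6 σ ν) ∧
    -- (b) for every leader strategy, the worst NE cost is exactly 1 + max(σ(r1), σ(r2))
    (∀ σ : Fin 2 → ℚ, IsStrategy σ →
      (∃ ν : Fin 2 → ℕ, IsConfig 1 ν ∧ IsNE cf6 σ ν ∧
        leaderCost cl6 σ ν = 1 + max (σ 0) (σ 1)) ∧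
      (∀ ν : Fin 2 → ℕ, IsConfig 1 ν → IsNE cf6 σ ν →
        leaderCost cl6 σ ν ≤ 1 + max (σ 0) (σ 1))) ∧
    -- (c) a PSE exists; every PSE has σ(r1) = σ(r2) = 1/2 and leader's cost 3/2 (in
    -- particular no PSE has a pure leader strategy) ...
    (∃ (σ : Fin 2 → ℚ) (ν : Fin 2 → ℕ), IsPSE6 σ ν) ∧
    (∀ (σ : Fin 2 → ℚ) (ν : Fin 2 → ℕ), IsPSE6 σ ν →
      σ 0 = 1 / 2 ∧ σ 1 = 1 / 2 ∧ leaderCost cl6 σ ν = 3 / 2) ∧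
    (∀ (σ : Fin 2 → ℚ) (ν : Fin 2 → ℕ), IsPSE6 σ ν → ¬ ∃ i, σ i = 1) ∧
    -- ... while each pure commitment yields worst-case leader's cost 2
    (∀ σ : Fin 2 → ℚ, IsStrategy σ → (∃ i, σ i = 1) →
      ∃ ν : Fin 2 → ℕ, IsConfig 1 ν ∧ IsNE cf6 σ ν ∧ leaderCost cl6 σ ν = 2) := by
  refine ⟨fun σ _ ν _ => isNE_cf6 σ ν,
    fun σ hσ => ⟨exists_leaderCost_cl6_eq hσ, fun ν hν _ => leaderCost_cl6_le hσ hν⟩,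
    exists_isPSE6, fun σ ν h => h.eq_half, fun σ ν h hpure => ?_, fun σ hσ hpure => ?_⟩
  · obtain ⟨h0, h1, -⟩ := h.eq_half
    have := h.1.max_eq_one hpure
    rw [h0, h1] at this
    norm_num at this
  · obtain ⟨ν, hν, hNE, hcost⟩ := exists_leaderCost_cl6_eq hσ
    refine ⟨ν, hν, hNE, ?_⟩
    rw [hcost, hσ.max_eq_one hpure]
    norm_num
end

section
/- Consider the SSSCG with one follower (|F| = 1), two resources R = {r1, r2}, nonmonotonic leader costs c_{r1,ℓ}(1) = c_{r2,ℓ}(1) = 2, c_{r1,ℓ}(2) = c_{r2,ℓ}(2) = 0, and monotonic follower costs c_{r1,f}(1) = c_{r2,f}(1) = 1, c_{r1,f}(2) = c_{r2,f}(2) = 2. Then for every leader strategy σ_ℓ and every ν ∈ E^{σ_ℓ}, c_ℓ^{(σ_ℓ,ν)} ≥ 1, with equality if and only if σ_ℓ(r1) = σ_ℓ(r2) = 1/2. In particular, every optimistic and every pessimistic Stackelberg equilibrium of this game prescribes the leader the mixed strategy σ_ℓ(r1) = σ_ℓ(r2) = 1/2. -/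
open Finset

/-- Nonmonotonic leader's costs: `c_{r,ℓ}(1) = 2, c_{r,ℓ}(2) = 0` on both resources. -/
def cl8 : Fin 2 → ℕ → ℚ := fun _ x => if x = 0 then 0 else if x = 1 then 2 else 0

/-- Monotonic followers' costs: `c_{r,f}(1) = 1, c_{r,f}(2) = 2` on both resources. -/
def cf8 : Fin 2 → ℕ → ℚ := fun _ x => if x = 0 then 0 else if x = 1 then 1 else 2

/-- `(σ, ν)` is an optimistic Stackelberg equilibrium of the game. -/
def IsOSE8 (σ : Fin 2 → ℚ) (ν : Fin 2 → ℕ) : Prop :=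
  IsStrategy σ ∧ IsConfig 1 ν ∧ IsNE cf8 σ ν ∧
  (∀ (σ' : Fin 2 → ℚ) (ν' : Fin 2 → ℕ), IsStrategy σ' → IsConfig 1 ν' → IsNE cf8 σ' ν' →
    leaderCost cl8 σ ν ≤ leaderCost cl8 σ' ν')

/-- `(σ, ν)` is a pessimistic Stackelberg equilibrium of the game. -/
def IsPSE8 (σ : Fin 2 → ℚ) (ν : Fin 2 → ℕ) : Prop :=
  IsStrategy σ ∧ IsConfig 1 ν ∧ IsNE cf8 σ ν ∧
  (∀ ν'' : Fin 2 → ℕ, IsConfig 1 ν'' → IsNE cf8 σ ν'' →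
    leaderCost cl8 σ ν'' ≤ leaderCost cl8 σ ν) ∧
  (∀ σ' : Fin 2 → ℚ, IsStrategy σ' →
    ∃ ν' : Fin 2 → ℕ, IsConfig 1 ν' ∧ IsNE cf8 σ' ν' ∧
      leaderCost cl8 σ ν ≤ leaderCost cl8 σ' ν')

/-- In every equilibrium the follower sits on a resource which the leader selects with
probability at most `1 / 2`, and the leader pays twice the probability of the other resource. -/
theorem leaderCost_cl8_eq {σ : Fin 2 → ℚ} {ν : Fin 2 → ℕ} (hν : IsConfig 1 ν)
    (hNE : IsNE cf8 σ ν) :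
    (leaderCost cl8 σ ν = 2 * σ 1 ∧ σ 0 ≤ σ 1) ∨ (leaderCost cl8 σ ν = 2 * σ 0 ∧ σ 1 ≤ σ 0) := by
  have hsum : ν 0 + ν 1 = 1 := by simpa [IsConfig, Fin.sum_univ_two] using hν
  obtain ⟨h0, h1⟩ | ⟨h0, h1⟩ : (ν 0 = 1 ∧ ν 1 = 0) ∨ (ν 0 = 0 ∧ ν 1 = 1) := by omega
  · have h := hNE 0 1 (by decide) (by omega)
    norm_num [expCost, cf8, h0, h1] at h
    refine Or.inl ⟨?_, by linarith⟩
    norm_num [leaderCost, cl8, Fin.sum_univ_two, h0, h1, mul_comm]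
  · have h := hNE 1 0 (by decide) (by omega)
    norm_num [expCost, cf8, h0, h1] at h
    refine Or.inr ⟨?_, by linarith⟩
    norm_num [leaderCost, cl8, Fin.sum_univ_two, h0, h1, mul_comm]

theorem one_le_leaderCost_cl8 {σ : Fin 2 → ℚ} {ν : Fin 2 → ℕ} (hσ : IsStrategy σ)
    (hν : IsConfig 1 ν) (hNE : IsNE cf8 σ ν) :
    1 ≤ leaderCost cl8 σ ν ∧ (leaderCost cl8 σ ν = 1 ↔ σ 0 = 1 / 2 ∧ σ 1 = 1 / 2) := by
  have hsum : σ 0 + σ 1 = 1 := by simpa [Fin.sum_univ_two] using hσ.2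
  rcases leaderCost_cl8_eq hν hNE with ⟨hc, hle⟩ | ⟨hc, hle⟩ <;> rw [hc] <;>
    exact ⟨by linarith, fun h => ⟨by linarith, by linarith⟩, fun h => by linarith [h.1, h.2]⟩

theorem isConfig_one_zero : IsConfig 1 (![1, 0] : Fin 2 → ℕ) := by
  simp [IsConfig]

theorem isNE_half : IsNE cf8 (fun _ => 1 / 2) ![1, 0] := by
  intro i j hij hi
  fin_cases i <;> fin_cases j <;> simp_all [expCost, cf8]

theorem stmt8 :
    -- for every leader strategy and every NE, the leader's cost is at least 1,
    -- with equality iff σ(r1) = σ(r2) = 1/2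
    (∀ (σ : Fin 2 → ℚ) (ν : Fin 2 → ℕ), IsStrategy σ → IsConfig 1 ν → IsNE cf8 σ ν →
      1 ≤ leaderCost cl8 σ ν ∧
      (leaderCost cl8 σ ν = 1 ↔ σ 0 = 1 / 2 ∧ σ 1 = 1 / 2)) ∧
    -- in particular, every OSE and every PSE prescribes the mixed strategy (1/2, 1/2)
    (∀ (σ : Fin 2 → ℚ) (ν : Fin 2 → ℕ), IsOSE8 σ ν → σ 0 = 1 / 2 ∧ σ 1 = 1 / 2) ∧
    (∀ (σ : Fin 2 → ℚ) (ν : Fin 2 → ℕ), IsPSE8 σ ν → σ 0 = 1 / 2 ∧ σ 1 = 1 / 2) := by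
  refine ⟨fun σ ν hσ hν hNE => one_le_leaderCost_cl8 hσ hν hNE, ?_, ?_⟩
  · rintro σ ν ⟨hσ, hν, hNE, hopt⟩
    have hle := hopt _ _ isStrategy_half isConfig_one_zero isNE_half
    rw [(one_le_leaderCost_cl8 isStrategy_half isConfig_one_zero isNE_half).2.2 ⟨rfl, rfl⟩] at hle
    obtain ⟨hge, hiff⟩ := one_le_leaderCost_cl8 hσ hν hNE
    exact hiff.1 (le_antisymm hle hge)
  · rintro σ ν ⟨hσ, hν, hNE, -, hopt⟩
    obtain ⟨ν', hν', hNE', hle⟩ := hopt _ isStrategy_half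
    rw [(one_le_leaderCost_cl8 isStrategy_half hν' hNE').2.2 ⟨rfl, rfl⟩] at hle
    obtain ⟨hge, hiff⟩ := one_le_leaderCost_cl8 hσ hν hNE
    exact hiff.1 (le_antisymm hle hge)
end

section
/- Let x_1, …, x_N be positive integers with N even, Σ_i x_i even, s := (Σ_i x_i)/2, x_i ≤ s for all i, and w_i := x_i/s; fix an integer K with 1 ≤ K ≤ N/2 and a rational ε with 0 < ε < 1. In the game Γ_ε(S,K) (an SSSCG defined in the context), there exist a leader strategy σ_ℓ and a configuration ν ∈ E^{σ_ℓ} with leader's expected cost c_ℓ^{(σ_ℓ,ν)} = ε if and only if there exists a set I ⊆ {1, …, N} with |I| = K and Σ_{i∈I} x_i = s. -/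
open Finset

/-! The game `Γ_ε(S,K)`. Resources are `Sum.inl i` (the resource `r_i` associated with the
integer `x_i`, `i < N`), `Sum.inr false` (the resource `r_{t1}`) and `Sum.inr true` (the
resource `r_{t2}`). There are `4N + 2` followers. Below, `w_i = x_i / s`, so that
`1 / w_i = s / x_i`. -/

/-- The followers' cost functions of `Γ_ε(S,K)`. -/
def cfGK (N K s : ℕ) (x : Fin N → ℕ) : Fin N ⊕ Bool → ℕ → ℚ := fun r m =>
  match r with
  | Sum.inl i =>
      if m = 0 then 0
      else if m = 1 then 2 * (s : ℚ)
      else if m = 2 then 0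
      else if m = 3 then (s : ℚ) / (x i : ℚ)
      else if m = 4 then (2 * (s : ℚ) - (s : ℚ) / (x i : ℚ) + 1) * ((s : ℚ) / (x i : ℚ))
      else 4 * (s : ℚ) ^ 2
  | Sum.inr false =>
      if m = 0 then 0
      else if m ≤ 4 * N - 2 * K then 3 * (s : ℚ) ^ 2
      else if m = 4 * N - 2 * K + 1 then 2 * (s : ℚ)
      else if m = 4 * N - 2 * K + 2 then 1
      else 0
  | Sum.inr true =>
      if m = 0 then 0 else if m = 1 then 1 else 4 * (s : ℚ) ^ 2

/-- The leader's cost functions of `Γ_ε(S,K)`. -/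
def clGK (N s : ℕ) (ε : ℚ) : Fin N ⊕ Bool → ℕ → ℚ := fun r m =>
  match r with
  | Sum.inl _ => if m = 0 then 0 else if m = 3 then ε else (s : ℚ)
  | Sum.inr _ => if m = 0 then 0 else (s : ℚ) ^ 4

/-- A leader strategy whose expected cost equals the cheapest cost `ε` only uses resources of
cost `ε`. -/
theorem leader_cost_eq_of_mem_support {R : Type} [Fintype R] {cl : R → ℕ → ℚ} {σ : R → ℚ}
    {ν : R → ℕ} {ε : ℚ} (hσ : IsStrategy σ) (hle : ∀ r, ε ≤ cl r (ν r + 1))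
    (hcost : leaderCost cl σ ν = ε) (r : R) (hr : σ r ≠ 0) : cl r (ν r + 1) = ε := by
  have h0 : ∑ r, σ r * (cl r (ν r + 1) - ε) = 0 := by
    simp only [mul_sub, sum_sub_distrib, ← sum_mul, hσ.2]
    rw [leaderCost] at hcost
    rw [hcost]; ring
  rw [sum_eq_zero_iff_of_nonneg
    (fun r _ => mul_nonneg (hσ.1 r) (sub_nonneg.2 (hle r)))] at h0
  have := (mul_eq_zero.1 (h0 r (mem_univ r))).resolve_left hr
  linarith

theorem expCost_zero (c : ℕ → ℚ) (m : ℕ) : expCost c 0 m = c m := by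
  simp [expCost]

section GameCosts

variable {N K s : ℕ} {x : Fin N → ℕ}

theorem clGK_inl_of_ne {ε : ℚ} (i : Fin N) {m : ℕ} (hm : m + 1 ≠ 3) :
    clGK N s ε (Sum.inl i) (m + 1) = s := by
  simp only [clGK]
  rw [if_neg (by omega), if_neg hm]

theorem clGK_inr {ε : ℚ} (b : Bool) (m : ℕ) :
    clGK N s ε (Sum.inr b) (m + 1) = (s : ℚ) ^ 4 := by
  simp [clGK]

theorem le_clGK {ε : ℚ} (hs : (1 : ℚ) ≤ s) (hε1 : ε < 1) (r : Fin N ⊕ Bool) (m : ℕ) :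
    ε ≤ clGK N s ε r (m + 1) := by
  obtain i | b := r
  · by_cases hm : m + 1 = 3
    · simp [clGK, hm]
    · rw [clGK_inl_of_ne i hm]; linarith
  · rw [clGK_inr]
    have := one_le_pow₀ (n := 4) hs
    linarith

theorem expCost_inl_one (i : Fin N) (p : ℚ) :
    expCost (cfGK N K s x (Sum.inl i)) p 1 = (1 - p) * (2 * s) := by
  simp [expCost, cfGK]

theorem expCost_inl_two (i : Fin N) (p : ℚ) :
    expCost (cfGK N K s x (Sum.inl i)) p 2 = p * ((s : ℚ) / x i) := by
  simp [expCost, cfGK]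

theorem expCost_inl_three (i : Fin N) (p : ℚ) :
    expCost (cfGK N K s x (Sum.inl i)) p 3 =
      (s : ℚ) / x i * (1 + p * (2 * s - (s : ℚ) / x i)) := by
  simp [expCost, cfGK]; ring

theorem cfGK_inl_four (i : Fin N) :
    cfGK N K s x (Sum.inl i) 4 =
      (2 * (s : ℚ) - s / x i + 1) * (s / x i) := by
  simp [cfGK]

theorem cfGK_inl_of_five_le (i : Fin N) {m : ℕ} (hm : 5 ≤ m) :
    cfGK N K s x (Sum.inl i) m = 4 * (s : ℚ) ^ 2 := by
  simp only [cfGK]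
  rw [if_neg (by omega), if_neg (by omega), if_neg (by omega), if_neg (by omega),
    if_neg (by omega)]

theorem cfGK_t1_of_le {m : ℕ} (hm0 : 0 < m) (hm : m ≤ 4 * N - 2 * K) :
    cfGK N K s x (Sum.inr false) m = 3 * (s : ℚ) ^ 2 := by
  simp only [cfGK]
  rw [if_neg (by omega), if_pos hm]

theorem cfGK_t1_succ : cfGK N K s x (Sum.inr false) (4 * N - 2 * K + 1) = 2 * (s : ℚ) := by
  simp [cfGK]

theorem cfGK_t1_add_two : cfGK N K s x (Sum.inr false) (4 * N - 2 * K + 2) = 1 := by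
  simp [cfGK]

theorem cfGK_t1_of_add_three_le {m : ℕ} (hm : 4 * N - 2 * K + 3 ≤ m) :
    cfGK N K s x (Sum.inr false) m = 0 := by
  simp only [cfGK]
  rw [if_neg (by omega), if_neg (by omega), if_neg (by omega), if_neg (by omega)]

theorem cfGK_t2_one : cfGK N K s x (Sum.inr true) 1 = 1 := by
  simp [cfGK]

theorem cfGK_t2_of_two_le {m : ℕ} (hm : 2 ≤ m) :
    cfGK N K s x (Sum.inr true) m = 4 * (s : ℚ) ^ 2 := by
  simp only [cfGK]
  rw [if_neg (by omega), if_neg (by omega)]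

theorem one_le_inv_weight (hxpos : ∀ i, 0 < x i) (hxle : ∀ i, x i ≤ s) (i : Fin N) :
    1 ≤ (s : ℚ) / x i := by
  have h1 : (0 : ℚ) < x i := by exact_mod_cast hxpos i
  have h2 : (x i : ℚ) ≤ s := by exact_mod_cast hxle i
  rwa [le_div_iff₀ h1, one_mul]

theorem inv_weight_le (hxpos : ∀ i, 0 < x i) (i : Fin N) : (s : ℚ) / x i ≤ s := by
  have h1 : (1 : ℚ) ≤ x i := by exact_mod_cast hxpos i
  exact div_le_self (by positivity) h1

/-- The expected cost of `r_i` at congestion three is always moderate. -/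
theorem expCost_inl_three_le (hxpos : ∀ i, 0 < x i) (hxle : ∀ i, x i ≤ s) (i : Fin N) {p : ℚ}
    (hp1 : p ≤ 1) :
    expCost (cfGK N K s x (Sum.inl i)) p 3 ≤ 2 * (s : ℚ) ^ 2 := by
  rw [expCost_inl_three]
  have hu1 := one_le_inv_weight hxpos hxle i
  have hus := inv_weight_le (s := s) hxpos i
  set u := (s : ℚ) / x i
  have hs : (1 : ℚ) ≤ s := hu1.trans hus
  have h1 : 1 + p * (2 * s - u) ≤ 1 + 1 * (2 * s - u) := by gcongr; linarith
  have h2 : u * (1 + p * (2 * s - u)) ≤ u * (1 + 1 * (2 * s - u)) := by gcongr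
  nlinarith [mul_nonneg (sub_nonneg.2 hus) (sub_nonneg.2 hus),
    mul_nonneg (sub_nonneg.2 hs) (sub_nonneg.2 hs)]

end GameCosts

/-- The set on which the leader randomizes solves the partition instance. -/
theorem exists_partition_of_equilibrium {N K s : ℕ} {x : Fin N → ℕ}
    (hs : 1 ≤ s) (hxpos : ∀ i, 0 < x i) (hxle : ∀ i, x i ≤ s) (hsum : ∑ i, x i = 2 * s)
    (hK2 : 2 * K ≤ N) {σ : Fin N ⊕ Bool → ℚ} {ν : Fin N ⊕ Bool → ℕ}
    (hσ : IsStrategy σ) (hν : IsConfig (4 * N + 2) ν) (hNE : IsNE (cfGK N K s x) σ ν)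
    (hinr : ∀ b, σ (Sum.inr b) = 0) (hinl : ∀ i, σ (Sum.inl i) ≠ 0 → ν (Sum.inl i) = 2) :
    ∃ I : Finset (Fin N), I.card = K ∧ ∑ i ∈ I, x i = s := by
  have hs1 : (1 : ℚ) ≤ s := by exact_mod_cast hs
  have hssq : (1 : ℚ) ≤ (s : ℚ) ^ 2 := one_le_pow₀ hs1
  have hx0 : ∀ i, (0 : ℚ) < x i := fun i => by exact_mod_cast hxpos i
  have hu1 := one_le_inv_weight hxpos hxle
  have hus := fun i => inv_weight_le (s := s) hxpos i
  have hσsum : ∑ i, σ (Sum.inl i) = 1 := by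
    have := hσ.2
    simpa [Fintype.sum_sum_type, hinr] using this
  have hνsum : ∑ i, ν (Sum.inl i) + (ν (Sum.inr true) + ν (Sum.inr false)) = 4 * N + 2 := by
    have := hν
    simpa [IsConfig, Fintype.sum_sum_type] using this
  have hσle : ∀ i, σ (Sum.inl i) ≤ 1 := fun i => by
    rw [← hσsum]
    exact single_le_sum (f := fun i => σ (Sum.inl i)) (fun j _ => hσ.1 _) (mem_univ i)
  obtain ⟨i₀, hi₀⟩ : ∃ i, σ (Sum.inl i) ≠ 0 := by
    by_contra! h
    simp [h] at hσsum
  have ha₀ := hinl i₀ hi₀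
  have hp₀ : 0 < σ (Sum.inl i₀) := lt_of_le_of_ne (hσ.1 _) hi₀.symm
  have hdev₀ := expCost_inl_three_le (K := K) hxpos hxle i₀ (hσle i₀)
  have hbound : ∀ r, r ≠ Sum.inl i₀ → 0 < ν r →
      expCost (cfGK N K s x r) (σ r) (ν r) ≤ 2 * (s : ℚ) ^ 2 := fun r hr h => by
    have := hNE r (Sum.inl i₀) hr h
    rw [ha₀] at this
    exact this.trans hdev₀
  have hfour : ∀ i, ν (Sum.inl i) ≤ 4 := fun i => by
    by_contra! h
    have h0 : σ (Sum.inl i) = 0 := by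
      by_contra h'
      have := hinl i h'
      omega
    have := hbound (Sum.inl i) (by rintro h'; rw [h'] at h; omega) (by omega)
    rw [h0, expCost_zero, cfGK_inl_of_five_le i (by omega)] at this
    linarith
  have hle4 : ∑ i, ν (Sum.inl i) ≤ 4 * N := by
    have := sum_le_sum (s := univ) (fun i _ => hfour i)
    simpa [mul_comm] using this
  have ht2le : ν (Sum.inr true) ≤ 1 := by
    by_contra! h
    have := hbound (Sum.inr true) (by simp) (by omega)
    rw [hinr, expCost_zero, cfGK_t2_of_two_le (by omega)] at this
    linarith
  have ht1 : 4 * N - 2 * K + 1 ≤ ν (Sum.inr false) := by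
    by_contra! h
    have := hbound (Sum.inr false) (by simp) (by omega)
    rw [hinr, expCost_zero, cfGK_t1_of_le (by omega) (by omega)] at this
    linarith
  have hcost₀ : 0 < expCost (cfGK N K s x (Sum.inl i₀)) (σ (Sum.inl i₀)) 2 := by
    rw [expCost_inl_two]
    exact mul_pos hp₀ (by linarith [hu1 i₀])
  have ht1eq : ν (Sum.inr false) = 4 * N - 2 * K + 1 := by
    by_contra h
    have := hNE (Sum.inl i₀) (Sum.inr false) (by simp) (by omega)
    rw [hinr, expCost_zero, cfGK_t1_of_add_three_le (by omega), ha₀] at this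
    linarith
  have ht2 : ν (Sum.inr true) = 1 := by
    by_contra h
    have := hNE (Sum.inr false) (Sum.inr true) (by simp) (by omega)
    rw [hinr, hinr, expCost_zero, expCost_zero, ht1eq, cfGK_t1_succ,
      show ν (Sum.inr true) + 1 = 1 by omega, cfGK_t2_one] at this
    linarith
  have hcostle : ∀ i, 0 < ν (Sum.inl i) →
      expCost (cfGK N K s x (Sum.inl i)) (σ (Sum.inl i)) (ν (Sum.inl i)) ≤ 1 := fun i hi => by
    have := hNE (Sum.inl i) (Sum.inr false) (by simp) hi
    rwa [hinr, expCost_zero (cfGK N K s x (Sum.inr false)), ht1eq, cfGK_t1_add_two] at this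
  have hdev : ∀ i, 2 * (s : ℚ) ≤
      expCost (cfGK N K s x (Sum.inl i)) (σ (Sum.inl i)) (ν (Sum.inl i) + 1) := fun i => by
    have := hNE (Sum.inr false) (Sum.inl i) (by simp) (by omega)
    rwa [hinr, expCost_zero (cfGK N K s x (Sum.inr false)), ht1eq, cfGK_t1_succ] at this
  have hweight : ∀ i, σ (Sum.inl i) ≠ 0 → σ (Sum.inl i) * s = x i := fun i hi => by
    have h1 := hdev i
    have h2 := hcostle i (by rw [hinl i hi]; norm_num)
    rw [hinl i hi, expCost_inl_two] at h2
    rw [hinl i hi, expCost_inl_three] at h1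
    have h3 : 1 ≤ σ (Sum.inl i) * (s / x i) := by
      by_contra! h
      nlinarith [hus i]
    have h4 : σ (Sum.inl i) * (s / x i) = 1 := le_antisymm h2 h3
    have := hx0 i
    field_simp at h4
    exact h4
  have hoff : ∀ i, σ (Sum.inl i) = 0 →
      ν (Sum.inl i) = 0 ∨ ν (Sum.inl i) = 3 ∧ x i = s := fun i hi => by
    have h1 := hdev i
    have h2 := hcostle i
    have h3 := hfour i
    have hu1 := hu1 i
    have hus := hus i
    rw [hi] at h1 h2
    generalize ν (Sum.inl i) = a at *
    interval_cases a
    · exact Or.inl rfl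
    · rw [expCost_inl_two] at h1
      linarith
    · rw [expCost_inl_three] at h1
      linarith
    · right
      have h2 := h2 (by norm_num)
      rw [expCost_inl_three] at h2
      have h4 : (s : ℚ) / x i = 1 := by linarith
      have := hx0 i
      field_simp at h4
      exact ⟨rfl, by exact_mod_cast h4.symm⟩
    · have h2 := h2 (by norm_num)
      rw [expCost_zero, cfGK_inl_four] at h2
      nlinarith
  set I : Finset (Fin N) := univ.filter fun i => σ (Sum.inl i) ≠ 0 with hI
  set J : Finset (Fin N) := univ.filter fun i => ν (Sum.inl i) = 3 with hJ
  have hIsum : ∑ i ∈ I, x i = s := by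
    have h : ∑ i ∈ I, (x i : ℚ) = s := by
      rw [hI, ← sum_congr rfl fun i hi => hweight i (mem_filter.1 hi).2, ← sum_mul,
        sum_filter_ne_zero, hσsum, one_mul]
    exact_mod_cast h
  have hdisj : Disjoint I J := disjoint_left.2 fun i hi hj => by
    have := hinl i (mem_filter.1 hi).2
    have := (mem_filter.1 hj).2
    omega
  have hJx : ∀ i ∈ J, x i = s := fun i hi => by
    have h3 := (mem_filter.1 hi).2
    by_cases h : σ (Sum.inl i) = 0
    · have := hoff i h
      omega
    · have := hinl i h
      omega
  have hJcard : J.card ≤ 1 := by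
    have h1 : ∑ i ∈ I ∪ J, x i ≤ ∑ i, x i := sum_le_sum_of_subset (subset_univ _)
    rw [sum_union hdisj, hIsum, hsum, sum_congr rfl hJx, sum_const, smul_eq_mul] at h1
    nlinarith
  have hcount : ∑ i, ν (Sum.inl i) = 2 * I.card + 3 * J.card := by
    have h : ∀ i, ν (Sum.inl i) =
        2 * (if σ (Sum.inl i) ≠ 0 then 1 else 0) + 3 * (if ν (Sum.inl i) = 3 then 1 else 0) :=
      fun i => by
        by_cases h : σ (Sum.inl i) = 0
        · rcases hoff i h with h' | h' <;> simp [h, h']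
        · simp [h, hinl i h]
    rw [sum_congr rfl fun i _ => h i, sum_add_distrib, ← mul_sum, ← mul_sum, card_filter,
      card_filter]
  exact ⟨I, by omega, hIsum⟩

/-- Playing each `r_i` of a partition class with probability `w_i` induces an equilibrium of
leader's cost `ε`. -/
theorem exists_equilibrium_of_partition {N K s : ℕ} {x : Fin N → ℕ}
    (hs : 1 ≤ s) (hxpos : ∀ i, 0 < x i) (hK2 : 2 * K ≤ N) (ε : ℚ)
    {I : Finset (Fin N)} (hIcard : I.card = K) (hIsum : ∑ i ∈ I, x i = s) :
    ∃ (σ : Fin N ⊕ Bool → ℚ) (ν : Fin N ⊕ Bool → ℕ),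
      IsStrategy σ ∧ IsConfig (4 * N + 2) ν ∧ IsNE (cfGK N K s x) σ ν ∧
      leaderCost (clGK N s ε) σ ν = ε := by
  have hs1 : (1 : ℚ) ≤ s := by exact_mod_cast hs
  have hx0 : ∀ i, (0 : ℚ) < x i := fun i => by exact_mod_cast hxpos i
  set σ : Fin N ⊕ Bool → ℚ := Sum.elim (fun i => if i ∈ I then (x i : ℚ) / s else 0) fun _ => 0
    with hσ
  set ν : Fin N ⊕ Bool → ℕ := Sum.elim (fun i => if i ∈ I then 2 else 0)
    fun b => if b then 1 else 4 * N - 2 * K + 1 with hν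
  have hsum1 : ∑ i ∈ I, (x i : ℚ) / s = 1 := by
    rw [← sum_div, ← Nat.cast_sum, hIsum, div_self (by positivity)]
  have hmul : ∀ i, (x i : ℚ) / s * (s / x i) = 1 := fun i => by
    have := hx0 i
    field_simp
  have hnow : ∀ r, 0 < ν r → r ≠ Sum.inr false →
      expCost (cfGK N K s x r) (σ r) (ν r) = 1 := by
    rintro (i | _ | _) h hne
    · by_cases hi : i ∈ I
      · simp only [hσ, hν, Sum.elim_inl, hi, if_true]
        rw [expCost_inl_two, hmul]
      · simp [hν, hi] at h
    · exact absurd rfl hne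
    · simp only [hσ, hν, Sum.elim_inr, if_true]
      rw [expCost_zero, cfGK_t2_one]
  have hthen : ∀ r, r ≠ Sum.inr false →
      2 * (s : ℚ) ≤ expCost (cfGK N K s x r) (σ r) (ν r + 1) := by
    rintro (i | _ | _) hne
    · by_cases hi : i ∈ I
      · simp only [hσ, hν, Sum.elim_inl, hi, if_true]
        rw [expCost_inl_three]
        apply le_of_eq
        linear_combination (-2 * (s : ℚ) + s / x i) * hmul i
      · simp only [hσ, hν, Sum.elim_inl, hi, if_false, zero_add]
        rw [expCost_inl_one]
        linarith
    · exact absurd rfl hne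
    · simp only [hσ, hν, Sum.elim_inr, if_true]
      rw [expCost_zero, cfGK_t2_of_two_le le_rfl]
      nlinarith
  have ht1 : expCost (cfGK N K s x (Sum.inr false)) (σ (Sum.inr false)) (ν (Sum.inr false)) =
      2 * s := by
    simp only [hσ, hν, Sum.elim_inr, Bool.false_eq_true, if_false]
    rw [expCost_zero, cfGK_t1_succ]
  have ht1' : expCost (cfGK N K s x (Sum.inr false)) (σ (Sum.inr false))
      (ν (Sum.inr false) + 1) = 1 := by
    simp only [hσ, hν, Sum.elim_inr, Bool.false_eq_true, if_false]
    rw [expCost_zero, cfGK_t1_add_two]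
  refine ⟨σ, ν, ⟨?_, ?_⟩, ?_, ?_, ?_⟩
  · rintro (i | b)
    · simp only [hσ, Sum.elim_inl]
      split_ifs <;> positivity
    · simp [hσ]
  · simp [hσ, Fintype.sum_sum_type, hsum1]
  · simp only [IsConfig, hν, Fintype.sum_sum_type, Sum.elim_inl, Sum.elim_inr, sum_ite_mem,
      univ_inter, sum_const, hIcard, smul_eq_mul, Fintype.sum_bool, if_true,
      Bool.false_eq_true, if_false]
    omega
  · intro i j hij hi
    by_cases h : i = Sum.inr false
    · subst h
      rw [ht1]
      exact hthen j hij.symm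
    · rw [hnow i hi h]
      by_cases hj : j = Sum.inr false
      · rw [hj, ht1']
      · linarith [hthen j hj]
  · have h : ∀ i, σ (Sum.inl i) * clGK N s ε (Sum.inl i) (ν (Sum.inl i) + 1) =
        σ (Sum.inl i) * ε := fun i => by
      by_cases hi : i ∈ I <;> simp [hσ, hν, hi, clGK]
    rw [leaderCost, Fintype.sum_sum_type, sum_congr rfl fun i _ => h i, ← sum_mul]
    simp [hσ, hsum1]

/-- In `Γ_ε(S,K)` there are a leader's strategy and an induced NE of leader's expected cost
exactly `ε` if and only if the `K`-PARTITION instance has answer yes. -/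
theorem stmt11 (N K s : ℕ) (x : Fin N → ℕ)
    (hNeven : Even N) (hxpos : ∀ i, 0 < x i) (hxle : ∀ i, x i ≤ s)
    (hsum : ∑ i, x i = 2 * s)
    (hK1 : 1 ≤ K) (hK2 : 2 * K ≤ N)
    (ε : ℚ) (hε0 : 0 < ε) (hε1 : ε < 1) :
    (∃ (σ : Fin N ⊕ Bool → ℚ) (ν : Fin N ⊕ Bool → ℕ),
        IsStrategy σ ∧ IsConfig (4 * N + 2) ν ∧ IsNE (cfGK N K s x) σ ν ∧
        leaderCost (clGK N s ε) σ ν = ε) ↔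
    (∃ I : Finset (Fin N), I.card = K ∧ ∑ i ∈ I, x i = s) := by
  have hN : 0 < N := by omega
  have hs : 1 ≤ s := (hxpos ⟨0, hN⟩).trans_le (hxle _)
  have hs1 : (1 : ℚ) ≤ s := by exact_mod_cast hs
  constructor
  · rintro ⟨σ, ν, hσ, hν, hNE, hcost⟩
    have hsupp := leader_cost_eq_of_mem_support hσ
      (fun r => le_clGK hs1 hε1 r (ν r)) hcost
    refine exists_partition_of_equilibrium hs hxpos hxle hsum hK2 hσ hν hNE
      (fun b => ?_) (fun i hi => ?_)
    · by_contra h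
      have h1 := hsupp _ h
      rw [clGK_inr] at h1
      have := one_le_pow₀ (n := 4) hs1
      linarith
    · by_contra h
      have h1 := hsupp _ hi
      rw [clGK_inl_of_ne i (by omega)] at h1
      linarith
  · rintro ⟨I, hIcard, hIsum⟩
    exact exists_equilibrium_of_partition hs hxpos hK2 ε hIcard hIsum
end

section
/- Let x_1, …, x_N be positive integers with N even, Σ_i x_i even, s := (Σ_i x_i)/2, s ≥ 2, x_i < s for all i, and w_i := x_i/s; fix a rational ε with 0 < ε < 1. If there is no set I ⊆ {1, …, N} with Σ_{i∈I} x_i = s, then in the game Γ_ε(S) (an SSSCG defined in the context), for every leader strategy σ_ℓ there exists a configuration ν ∈ E^{σ_ℓ} with leader's expected cost c_ℓ^{(σ_ℓ,ν)} ≥ 1. -/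
open Finset

/-! The game `Γ_ε(S)`. Resources are `some i` (the resource `r_i` associated with the
integer `x_i`, `i < N`) and `none` (the resource `r_t`). There are `3N` followers. Below,
`w_i = x_i / s`, so that `1/(w_i − 1/s⁴) = s⁴/(x_i·s³ − 1)` and
`1/(1 − w_i − 1/s⁴) = s⁴/(s⁴ − x_i·s³ − 1)`. -/

/-- The followers' cost functions of `Γ_ε(S)`. -/
def cfGP (N s : ℕ) (x : Fin N → ℕ) : Option (Fin N) → ℕ → ℚ := fun r m =>
  match r with
  | some i =>
      if m = 0 then 0
      else if m = 1 then 0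
      else if m = 2 then (s : ℚ) ^ 4 / ((x i : ℚ) * (s : ℚ) ^ 3 - 1)
      else if m = 3 then (s : ℚ) ^ 4 / ((s : ℚ) ^ 4 - (x i : ℚ) * (s : ℚ) ^ 3 - 1)
      else if m = 4 then 0
      else (s : ℚ)
  | none => if m = 0 then 0 else 1

/-- The leader's cost functions of `Γ_ε(S)`. -/
def clGP (N s : ℕ) (ε : ℚ) : Option (Fin N) → ℕ → ℚ := fun r m =>
  match r with
  | some _ => if m = 0 then 0 else if m = 2 ∨ m = 4 then (s : ℚ) ^ 4 else ε
  | none => if m = 0 then 0 else (s : ℚ) ^ 4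


/-- For every probability `σ (some i)` there is a congestion at which the followers on
`some i` pay at most `1` and a further follower would pay at least `1`. The congestion is `1`
or `3` unless `σ (some i)` is within `1 / s ^ 4` of `x i / s`. -/
lemma exists_stable_congestion {N s : ℕ} {x : Fin N → ℕ} (hs2 : 2 ≤ s) (i : Fin N)
    (hpos : 0 < x i) (hlt : x i < s) {p : ℚ} (hp0 : 0 ≤ p) (hp1 : p ≤ 1) :
    ∃ k : ℕ, k ≤ 3 ∧ (0 < k → expCost (cfGP N s x (some i)) p k ≤ 1) ∧
      1 ≤ expCost (cfGP N s x (some i)) p (k + 1) ∧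
      (k = 1 ∨ k = 3 ∨ |p * (s : ℚ) ^ 4 - x i * (s : ℚ) ^ 3| < 1) := by
  have hs : (2 : ℚ) ≤ s := by exact_mod_cast hs2
  have hx1 : (1 : ℚ) ≤ x i := by exact_mod_cast hpos
  have hx2 : (x i : ℚ) + 1 ≤ s := by exact_mod_cast hlt
  have hs3 : (8 : ℚ) ≤ (s : ℚ) ^ 3 := by
    calc (8 : ℚ) = 2 ^ 3 := by norm_num
      _ ≤ _ := by gcongr
  have hw : 0 < (x i : ℚ) * (s : ℚ) ^ 3 - 1 := by nlinarith
  have hw' : 0 < (s : ℚ) ^ 4 - (x i : ℚ) * (s : ℚ) ^ 3 - 1 := by nlinarith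
  rcases le_or_gt (p * (s : ℚ) ^ 4) (x i * (s : ℚ) ^ 3 - 1) with h | h
  · refine ⟨1, by norm_num, fun _ => ?_, ?_, Or.inl rfl⟩
    · simp only [expCost, cfGP]
      norm_num
      rw [← mul_div_assoc, div_le_one hw]
      exact h
    · have h2 : 1 ≤ (s : ℚ) ^ 4 / ((x i : ℚ) * (s : ℚ) ^ 3 - 1) := by
        rw [one_le_div hw]; linarith
      have h3 : 1 ≤ (s : ℚ) ^ 4 / ((s : ℚ) ^ 4 - (x i : ℚ) * (s : ℚ) ^ 3 - 1) := by
        rw [one_le_div hw']; linarith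
      simp only [expCost, cfGP]
      norm_num
      nlinarith [mul_le_mul_of_nonneg_left h3 hp0,
        mul_le_mul_of_nonneg_left h2 (sub_nonneg.2 hp1)]
  rcases le_or_gt (x i * (s : ℚ) ^ 3 + 1) (p * (s : ℚ) ^ 4) with h' | h'
  · refine ⟨3, le_rfl, fun _ => ?_, ?_, Or.inr (Or.inl rfl)⟩
    · simp only [expCost, cfGP]
      norm_num
      rw [← mul_div_assoc, div_le_one hw']
      linarith
    · simp only [expCost, cfGP]
      norm_num
      by_contra! hc
      nlinarith
  · refine ⟨0, by norm_num, fun h0 => absurd h0 (lt_irrefl 0), ?_, Or.inr (Or.inr ?_)⟩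
    · simp only [expCost, cfGP]
      norm_num
      rw [← mul_div_assoc, one_le_div hw]
      exact h.le
    · rw [abs_lt]; constructor <;> linarith

/-- A leader strategy that is close to `x i / s` on every resource carrying non-negligible
probability reveals a subset of the integers summing to `s`. -/
lemma sum_eq_of_strategy_near {N s : ℕ} {x : Fin N → ℕ} (hs2 : 2 ≤ s)
    (hxpos : ∀ i, 0 < x i) (hsum : ∑ i, x i = 2 * s) {σ : Option (Fin N) → ℚ}
    (hσ : IsStrategy σ) (I : Finset (Fin N))
    (hI : ∀ i ∈ I, |σ (some i) * (s : ℚ) ^ 4 - x i * (s : ℚ) ^ 3| < 1)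
    (hrest : (σ none + ∑ i ∈ Iᶜ, σ (some i)) * (s : ℚ) ^ 4 < 1) :
    ∑ i ∈ I, x i = s := by
  have hs : (2 : ℚ) ≤ s := by exact_mod_cast hs2
  have hN : (N : ℚ) ≤ 2 * s := by
    have : ∑ _i : Fin N, 1 ≤ ∑ i, x i := sum_le_sum fun i _ => hxpos i
    rw [hsum] at this
    simp only [sum_const, card_univ, Fintype.card_fin, smul_eq_mul, mul_one] at this
    exact_mod_cast this
  have htotal := hσ.2
  rw [Fintype.sum_option, ← sum_add_sum_compl I (fun i => σ (some i))] at htotal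
  have hrest0 : 0 ≤ (σ none + ∑ i ∈ Iᶜ, σ (some i)) * (s : ℚ) ^ 4 :=
    mul_nonneg (add_nonneg (hσ.1 _) (sum_nonneg fun i _ => hσ.1 _)) (by positivity)
  have hdist : |∑ i ∈ I, (σ (some i) * (s : ℚ) ^ 4 - x i * (s : ℚ) ^ 3)| ≤ N := by
    calc _ ≤ ∑ i ∈ I, |σ (some i) * (s : ℚ) ^ 4 - x i * (s : ℚ) ^ 3| := abs_sum_le_sum_abs _ _
      _ ≤ ∑ i ∈ I, 1 := sum_le_sum fun i hi => (hI i hi).le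
      _ ≤ N := by
        simp only [sum_const, nsmul_eq_mul, mul_one]
        exact_mod_cast (card_le_univ I).trans_eq (Fintype.card_fin N)
  rw [sum_sub_distrib, ← sum_mul, ← sum_mul, abs_le] at hdist
  have hmass : (∑ i ∈ I, σ (some i)) * (s : ℚ) ^ 4
      = (s : ℚ) ^ 4 - (σ none + ∑ i ∈ Iᶜ, σ (some i)) * (s : ℚ) ^ 4 := by
    linear_combination (s : ℚ) ^ 4 * htotal
  have hs3 : 2 * (s : ℚ) + 1 ≤ (s : ℚ) ^ 3 := by nlinarith [mul_le_mul hs hs (by norm_num) (by linarith)]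
  have hs3pos : (0 : ℚ) < (s : ℚ) ^ 3 := by positivity
  have hlow : (s : ℚ) < ∑ i ∈ I, (x i : ℚ) + 1 := by
    refine lt_of_mul_lt_mul_right ?_ hs3pos.le
    linarith [show (s : ℚ) * (s : ℚ) ^ 3 = (s : ℚ) ^ 4 by ring]
  have hupp : ∑ i ∈ I, (x i : ℚ) < s + 1 := by
    refine lt_of_mul_lt_mul_right ?_ hs3pos.le
    linarith [show (s : ℚ) * (s : ℚ) ^ 3 = (s : ℚ) ^ 4 by ring]
  have h1 : s < ∑ i ∈ I, x i + 1 := by exact_mod_cast hlow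
  have h2 : ∑ i ∈ I, x i < s + 1 := by exact_mod_cast hupp
  omega

/-- If the PARTITION instance has answer no, then in `Γ_ε(S)`, for every leader's strategy
there is an induced NE giving the leader an expected cost of at least `1`. -/
theorem stmt14 (N s : ℕ) (x : Fin N → ℕ)
    (hNeven : Even N) (hs2 : 2 ≤ s) (hxpos : ∀ i, 0 < x i) (hxlt : ∀ i, x i < s)
    (hsum : ∑ i, x i = 2 * s)
    (ε : ℚ) (hε0 : 0 < ε) (hε1 : ε < 1)
    (hno : ¬ ∃ I : Finset (Fin N), ∑ i ∈ I, x i = s) :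
    ∀ σ : Option (Fin N) → ℚ, IsStrategy σ →
      ∃ ν : Option (Fin N) → ℕ, IsConfig (3 * N) ν ∧ IsNE (cfGP N s x) σ ν ∧
        1 ≤ leaderCost (clGP N s ε) σ ν := by
  intro σ hσ
  have hle1 (i : Fin N) : σ (some i) ≤ 1 :=
    hσ.2 ▸ single_le_sum (fun j _ => hσ.1 j) (mem_univ (some i))
  choose k hk3 hkin hkout hk using fun i =>
    exists_stable_congestion hs2 i (hxpos i) (hxlt i) (hσ.1 (some i)) (hle1 i)
  have hksum : ∑ i, k i ≤ 3 * N := by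
    refine (sum_le_sum fun i _ => hk3 i).trans_eq ?_
    simp [mul_comm]
  have hnone (m : ℕ) (hm : 0 < m) : expCost (cfGP N s x none) (σ none) m = 1 := by
    simp [expCost, cfGP, hm.ne']
  refine ⟨fun r => r.elim (3 * N - ∑ i, k i) k, ?_, ?_, ?_⟩
  · simp only [IsConfig, Fintype.sum_option, Option.elim]
    omega
  · intro i j _ hi
    trans 1
    · cases i with
      | none => exact (hnone _ hi).le
      | some i => exact hkin i hi
    · cases j with
      | none => exact (hnone _ (Nat.succ_pos _)).ge
      | some j => exact hkout j
  · by_contra! hc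
    refine hno ⟨univ.filter fun i => |σ (some i) * (s : ℚ) ^ 4 - x i * (s : ℚ) ^ 3| < 1,
      sum_eq_of_strategy_near hs2 hxpos hsum hσ _ (fun i hi => (mem_filter.1 hi).2) ?_⟩
    refine lt_of_le_of_lt ?_ hc
    rw [leaderCost, Fintype.sum_option, add_mul, sum_mul]
    have hcl (i : Fin N) (m : ℕ) : 0 ≤ clGP N s ε (some i) m := by
      simp only [clGP]
      split_ifs <;> positivity
    refine add_le_add (by simp [clGP]) ?_
    calc _ ≤ ∑ i ∈ (univ.filter fun i =>
            |σ (some i) * (s : ℚ) ^ 4 - x i * (s : ℚ) ^ 3| < 1)ᶜ,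
          σ (some i) * clGP N s ε (some i) (k i + 1) := by
          refine sum_le_sum fun i hi => ?_
          have hfar : ¬ |σ (some i) * (s : ℚ) ^ 4 - x i * (s : ℚ) ^ 3| < 1 := by
            simpa only [mem_compl, mem_filter, mem_univ, true_and] using hi
          rcases hk i with h | h | h
          · simp [clGP, h]
          · simp [clGP, h]
          · exact absurd h hfar
      _ ≤ _ := sum_le_sum_of_subset_of_nonneg (subset_univ _)
          fun i _ _ => mul_nonneg (hσ.1 _) (hcl i _)
end

section
/- For every 3SAT instance (C, V) with m := |C| clauses, the singleton congestion game Γ(C,V) defined in the context admits a pure Nash equilibrium in which no player selects resource r_t if and only if (C, V) is satisfiable. -/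
open Finset

/-- A literal: a variable together with its polarity (`true` = positive). -/
abbrev Lit (V : Type) := V × Bool

/-- A 3SAT instance over variables `V`, with set of clauses `C`, is given by the function
`lit` assigning to each clause its three literals. It is satisfiable if some truth
assignment makes at least one literal of each clause true. -/
def Satisfiable {C V : Type} (lit : C → Fin 3 → Lit V) : Prop :=
  ∃ τ : V → Bool, ∀ φ : C, ∃ k : Fin 3, τ (lit φ k).1 = (lit φ k).2

/-- The resources of `Γ(C,V)`: `r_t`; `r_φ` for `φ ∈ C`; `r_l` and `r_{l,t}` for each
literal `l` (i.e. `r_v, r_v̄, r_{v,t}, r_{v̄,t}` for `v ∈ V`); and `r_{φ,l}` for `φ ∈ C`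
and each literal `l` (i.e. `r_{φ,v}, r_{φ,v̄}`). -/
inductive GRes (C V : Type) where
  | t
  | clause (φ : C)
  | lit (l : Lit V)
  | litT (l : Lit V)
  | clauseLit (φ : C) (l : Lit V)
  deriving DecidableEq

/-- The players of `Γ(C,V)`: `p_φ` and `p_{φ,t}` for `φ ∈ C`; `p_v` for `v ∈ V`;
`p_{v,k}, p_{v̄,k}` for `v ∈ V` and `k ∈ {1,…,m}`; and `p_{φ,v}, p_{φ,v̄}` for `φ ∈ C`,
`v ∈ V`. -/
inductive GPl (C V : Type) (m : ℕ) where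
  | pc (φ : C)
  | pct (φ : C)
  | pv (v : V)
  | plk (l : Lit V) (k : Fin m)
  | pcl (φ : C) (l : Lit V)
  deriving DecidableEq, Fintype

/-- The action sets of the players of `Γ(C,V)`. -/
def allowed {C V : Type} {m : ℕ} (lit : C → Fin 3 → Lit V) :
    GPl C V m → GRes C V → Prop
  | .pc φ, r => r = .clause φ ∨ ∃ k : Fin 3, r = .clauseLit φ (lit φ k)
  | .pct φ, r => r = .clause φ ∨ r = .t
  | .pv v, r => r = .t ∨ r = .litT (v, true) ∨ r = .litT (v, false)
  | .plk l _, r => r = .litT l ∨ r = .lit l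
  | .pcl φ l, r => r = .lit l ∨ r = .clauseLit φ l

/-- The congestion `ν_i^a` of resource `i` under the action profile `a`. -/
def cong {C V : Type} {m : ℕ} [Fintype C] [Fintype V] [DecidableEq C] [DecidableEq V]
    (a : GPl C V m → GRes C V) (i : GRes C V) : ℕ :=
  (univ.filter fun p => a p = i).card

/-- The cost functions of `Γ(C,V)` (as functions of the congestion `x ≥ 1`):
`c_{r_φ} = (2, 5, 5, …)`; `c_{r_l}(x) = 0` for `x ≤ m` and `7` for `x ≥ m+1`;
`c_{r_{l,t}} = (0, 6, 6, …)`; `c_{r_{φ,l}} = (1, 6, 6, …)`; `c_{r_t} ≡ 4`. -/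
def gcost {C V : Type} (m : ℕ) : GRes C V → ℕ → ℚ
  | .t, _ => 4
  | .clause _, n => if n ≤ 1 then 2 else 5
  | .lit _, n => if n ≤ m then 0 else 7
  | .litT _, n => if n ≤ 1 then 0 else 6
  | .clauseLit _ _, n => if n ≤ 1 then 1 else 6

/-- `a` is a pure Nash equilibrium of `Γ(C,V)`. -/
def gNE {C V : Type} {m : ℕ} [Fintype C] [Fintype V] [DecidableEq C] [DecidableEq V]
    (lit : C → Fin 3 → Lit V) (a : GPl C V m → GRes C V) : Prop :=
  ∀ p : GPl C V m, ∀ j : GRes C V, allowed lit p j →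
    gcost m (a p) (cong a (a p)) ≤ gcost m j (cong a j + 1)

lemma gcost_le_six {C V : Type} {m : ℕ} (i : GRes C V) (hi : ∀ l, i ≠ .lit l) (n : ℕ) :
    gcost m i n ≤ 6 := by
  cases i <;> simp only [gcost] <;>
    first | exact absurd rfl (hi _) | (split_ifs <;> norm_num) | norm_num

lemma gcost_nonneg {C V : Type} {m : ℕ} (i : GRes C V) (n : ℕ) : 0 ≤ gcost m i n := by
  cases i <;> simp only [gcost] <;> (try split_ifs) <;> norm_num

section Congestion

variable {C V : Type} {m : ℕ} [Fintype C] [Fintype V] [DecidableEq C] [DecidableEq V]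

lemma two_le_cong {a : GPl C V m → GRes C V} {i : GRes C V} {p q : GPl C V m}
    (hpq : p ≠ q) (hp : a p = i) (hq : a q = i) : 2 ≤ cong a i :=
  Finset.one_lt_card.2 ⟨p, by simp [hp], q, by simp [hq], hpq⟩

lemma cong_le_one {a : GPl C V m → GRes C V} {i : GRes C V}
    (h : ∀ p q, a p = i → a q = i → p = q) : cong a i ≤ 1 :=
  Finset.card_le_one.2 fun p hp q hq => h p q (by simpa using hp) (by simpa using hq)

lemma card_le_cong {ι : Type} [Fintype ι] {a : GPl C V m → GRes C V} {i : GRes C V}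
    (f : ι → GPl C V m) (hf : Function.Injective f) (h : ∀ x, a (f x) = i) :
    Fintype.card ι ≤ cong a i := by
  classical
  rw [← Finset.card_univ, ← Finset.card_image_of_injective univ hf]
  refine Finset.card_le_card fun p hp => ?_
  obtain ⟨x, -, rfl⟩ := Finset.mem_image.1 hp
  simp [h]

lemma cong_le_card {ι : Type} [Fintype ι] {a : GPl C V m → GRes C V} {i : GRes C V}
    (f : ι → GPl C V m) (h : ∀ p, a p = i → ∃ x, f x = p) :
    cong a i ≤ Fintype.card ι := by
  classical
  refine le_trans (Finset.card_le_card fun p hp => ?_) (Finset.card_image_le (s := univ) (f := f))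
  simpa using h p (by simpa using hp)

end Congestion

section Equilibrium

variable {C V : Type} [Fintype C] [DecidableEq C] [Fintype V] [DecidableEq V]

theorem satisfiable_of_gNE {lit : C → Fin 3 → Lit V}
    {a : GPl C V (Fintype.card C) → GRes C V}
    (hal : ∀ p, allowed lit p (a p)) (hNE : gNE lit a) (ht : ∀ p, a p ≠ GRes.t) :
    Satisfiable lit := by
  have hpct : ∀ φ, a (.pct φ) = .clause φ := fun φ => (hal (.pct φ)).resolve_right (ht _)
  refine ⟨fun v => decide (a (.pv v) = .litT (v, false)), fun φ => ?_⟩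
  have hpc : a (.pc φ) ≠ .clause φ := by
    intro h
    have h2 := two_le_cong (p := .pc φ) (q := .pct φ) (by simp) h (hpct φ)
    have h3 := hNE (.pct φ) .t (Or.inr rfl)
    rw [hpct φ] at h3
    simp only [gcost, if_neg (show ¬ cong a (.clause φ) ≤ 1 by omega)] at h3
    norm_num at h3
  obtain ⟨k, hk⟩ := (hal (.pc φ)).resolve_left hpc
  refine ⟨k, ?_⟩
  generalize lit φ k = l at hk ⊢
  have hpcl : a (.pcl φ l) = .lit l := by
    refine (hal (.pcl φ l)).resolve_right fun h => ?_
    have h2 := two_le_cong (p := .pc φ) (q := .pcl φ l) (by simp) hk h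
    have h3 := hNE (.pc φ) (.clause φ) (Or.inl rfl)
    rw [hk] at h3
    simp only [gcost, if_neg (show ¬ cong a (.clauseLit φ l) ≤ 1 by omega)] at h3
    split_ifs at h3 <;> norm_num at h3
  have hcong : cong a (.lit l) ≤ Fintype.card C := by
    by_contra hlt
    have h3 := hNE (.pcl φ l) (.clauseLit φ l) (Or.inr rfl)
    rw [hpcl] at h3
    simp only [gcost, if_neg hlt] at h3
    split_ifs at h3 <;> norm_num at h3
  obtain ⟨j, hj⟩ : ∃ j, a (.plk l j) = .litT l := by
    by_contra! hne
    have h := card_le_cong (a := a) (i := .lit l)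
      (fun o : Option (Fin (Fintype.card C)) => o.elim (GPl.pcl φ l) (GPl.plk l))
      (by rintro (_ | x) (_ | y) hxy <;> simp_all)
      (by
        rintro (_ | x)
        · exact hpcl
        · exact (hal (.plk l x)).resolve_left (hne x))
    simp at h
    omega
  have hpv : a (.pv l.1) ≠ .litT l := by
    intro h
    have h2 := two_le_cong (p := .pv l.1) (q := .plk l j) (by simp) h hj
    have h3 := hNE (.pv l.1) .t (Or.inl rfl)
    rw [h] at h3
    simp only [gcost, if_neg (show ¬ cong a (.litT l) ≤ 1 by omega)] at h3
    norm_num at h3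
  obtain ⟨v, b⟩ := l
  have hor := (hal (.pv v)).resolve_left (ht _)
  cases b <;> simp_all

/-- The action profile induced by a truth assignment `τ` and a choice `κ` of a literal in each
clause. -/
def assignmentProfile {m : ℕ} (lit : C → Fin 3 → Lit V) (τ : V → Bool) (κ : C → Fin 3) :
    GPl C V m → GRes C V
  | .pc φ => .clauseLit φ (lit φ (κ φ))
  | .pct φ => .clause φ
  | .pv v => .litT (v, !τ v)
  | .plk l _ => if τ l.1 = l.2 then .litT l else .lit l
  | .pcl φ l => if τ l.1 = l.2 then .lit l else .clauseLit φ l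

theorem gNE_assignmentProfile {lit : C → Fin 3 → Lit V} {τ : V → Bool} {κ : C → Fin 3}
    (hκ : ∀ φ, τ (lit φ (κ φ)).1 = (lit φ (κ φ)).2) :
    gNE lit (assignmentProfile (m := Fintype.card C) lit τ κ) := by
  set a := assignmentProfile (m := Fintype.card C) lit τ κ with ha
  have hclause : ∀ φ, cong a (.clause φ) ≤ 1 := fun φ => cong_le_one fun p q hp hq => by
    cases p <;> cases q <;> simp only [ha, assignmentProfile] at hp hq <;> grind
  have hclauseLit : ∀ φ l, cong a (.clauseLit φ l) ≤ 1 := fun φ l =>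
    cong_le_one fun p q hp hq => by
      cases p <;> cases q <;> simp only [ha, assignmentProfile] at hp hq <;> grind
  have hlitT : ∀ l : Lit V, τ l.1 ≠ l.2 → cong a (.litT l) ≤ 1 := fun l hl =>
    cong_le_one fun p q hp hq => by
      cases p <;> cases q <;> simp only [ha, assignmentProfile] at hp hq <;> grind
  have hlit : ∀ l, cong a (.lit l) = Fintype.card C := by
    intro l
    by_cases hl : τ l.1 = l.2
    · refine le_antisymm (cong_le_card (fun φ => .pcl φ l) fun p hp => ?_)
        (card_le_cong (fun φ => .pcl φ l) (fun x y h => by simpa using h) fun φ => ?_)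
      · cases p <;> simp only [ha, assignmentProfile] at hp <;> (try split_ifs at hp) <;> simp_all
      · simp [ha, assignmentProfile, hl]
    · refine (le_antisymm (cong_le_card (GPl.plk l) fun p hp => ?_)
        (card_le_cong (GPl.plk l) (fun x y h => by simpa using h) fun k => ?_)).trans
        (Fintype.card_fin _)
      · cases p <;> simp only [ha, assignmentProfile] at hp <;> (try split_ifs at hp) <;> simp_all
      · simp [ha, assignmentProfile, hl]
  have hdev : ∀ l, gcost (Fintype.card C) (.lit l : GRes C V) (cong a (.lit l) + 1) = 7 := by
    intro l
    simp [gcost, hlit]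
  have hstay : ∀ l, gcost (Fintype.card C) (.lit l : GRes C V) (cong a (.lit l)) = 0 := by
    intro l
    simp [gcost, hlit]
  intro p j hj
  cases p with
  | pc φ =>
    rw [show a (.pc φ) = .clauseLit φ (lit φ (κ φ)) from rfl]
    rcases hj with rfl | ⟨k, rfl⟩ <;> simp only [gcost, if_pos (hclauseLit _ _)] <;>
      split_ifs <;> norm_num
  | pct φ =>
    rw [show a (.pct φ) = .clause φ from rfl]
    rcases hj with rfl | rfl <;> simp only [gcost, if_pos (hclause _)] <;>
      (try split_ifs) <;> norm_num
  | pv v =>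
    rw [show a (.pv v) = .litT (v, !τ v) from rfl]
    refine le_of_eq_of_le ?_ (gcost_nonneg _ _)
    simp only [gcost, if_pos (hlitT (v, !τ v) (by simp))]
  | plk l k =>
    by_cases hl : τ l.1 = l.2
    · have h : a (.plk l k) = .litT l := by simp [ha, assignmentProfile, hl]
      rw [h]
      rcases hj with rfl | rfl
      · simp only [gcost]
        split_ifs <;> first | omega | norm_num
      · rw [hdev]
        exact (gcost_le_six _ (by simp) _).trans (by norm_num)
    · have h : a (.plk l k) = .lit l := by simp [ha, assignmentProfile, hl]
      rw [h, hstay]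
      exact gcost_nonneg _ _
  | pcl φ l =>
    by_cases hl : τ l.1 = l.2
    · have h : a (.pcl φ l) = .lit l := by simp [ha, assignmentProfile, hl]
      rw [h, hstay]
      exact gcost_nonneg _ _
    · have h : a (.pcl φ l) = .clauseLit φ l := by simp [ha, assignmentProfile, hl]
      rw [h]
      rcases hj with rfl | rfl
      · rw [hdev]
        exact (gcost_le_six _ (by simp) _).trans (by norm_num)
      · simp only [gcost, if_pos (hclauseLit _ _)]
        split_ifs <;> norm_num

end Equilibrium

/-- `Γ(C,V)` admits a pure NE in which no player selects `r_t` iff `(C,V)` is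
satisfiable. -/
theorem stmt15 {C V : Type} [Fintype C] [DecidableEq C] [Fintype V] [DecidableEq V]
    (lit : C → Fin 3 → Lit V) :
    (∃ a : GPl C V (Fintype.card C) → GRes C V,
        (∀ p, allowed lit p (a p)) ∧ gNE lit a ∧ (∀ p, a p ≠ GRes.t)) ↔
    Satisfiable lit := by
  constructor
  · rintro ⟨a, hal, hNE, ht⟩
    exact satisfiable_of_gNE hal hNE ht
  · rintro ⟨τ, hτ⟩
    choose κ hκ using hτ
    refine ⟨assignmentProfile lit τ κ, fun p => ?_, gNE_assignmentProfile hκ, fun p => ?_⟩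
    · cases p with
      | pv v => cases h : τ v <;> simp [assignmentProfile, allowed, h]
      | _ => simp only [assignmentProfile, allowed]; grind
    · cases p <;> simp only [assignmentProfile] <;> grind
end
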